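/- Let G be a trivalent, 2-edge-connected finite graph and B a basis of the graph curve matroid M_G. Then the number of connected components of G[B] equals the number of connected components of G[V−B]. -/

import Mathlib

/-- A finite undirected multigraph on vertex type `V` with edge type `E`:
each edge has an unordered pair of endpoints (possibly a loop). -/
structure Multigraph (V E : Type*) where
  ends : E → Sym2 V

namespace Multigraph

variable {V E : Type*} (G : Multigraph V E)

/-- `δ(A)`: the set of edges incident to at least one vertex of `A`. -/
def inc (A : Set V) : Set E := {e | ∃ v ∈ A, v ∈ G.ends e}

/-- Number of connected components of the spanning subgraph of `G`
with edge set `B` (on the full vertex set `V`). -/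
noncomputable def numComponentsEdges (B : Set E) : ℕ :=
  Nat.card (Quot (fun u v : V => ∃ e ∈ B, G.ends e = s(u, v)))

/-- Number of connected components `ω(S)` of the subgraph of `G` induced on `S`. -/
noncomputable def numComponentsSub (S : Set V) : ℕ :=
  Nat.card (Quot (fun x y : S => ∃ e, G.ends e = s(x.1, y.1)))

/-- Rank function of the cycle (graphic) matroid of `G`:
`r(B) = |V| - (number of components of (V, B))`. -/
noncomputable def cycleRank (B : Set E) : ℕ :=
  Nat.card V - G.numComponentsEdges B

/-- Rank function `r*` of the bond (cographic) matroid of `G`: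
`r*(B) = |B| + r(E - B) - r(E)`. -/
noncomputable def bondRank (B : Set E) : ℕ :=
  B.ncard + G.cycleRank Bᶜ - G.cycleRank Set.univ

/-- `G` is connected. -/
def Connected : Prop := G.numComponentsEdges Set.univ = 1

/-- `G` is 2-edge-connected: it is connected and deleting any single edge
leaves it connected. -/
def TwoEdgeConnected : Prop :=
  G.Connected ∧ ∀ e : E, G.numComponentsEdges {e}ᶜ = 1

/-- `G` is 2-vertex-connected: it is connected and deleting any single vertex
leaves it connected. -/
def TwoVertexConnected : Prop :=
  G.Connected ∧ ∀ v : V, G.numComponentsSub {v}ᶜ = 1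

/-- `G` has no loops. -/
def Loopless : Prop := ∀ e : E, ¬ (G.ends e).IsDiag

open Classical in
/-- The degree of a vertex, with loops counting twice. -/
noncomputable def degree [Fintype E] (v : V) : ℕ :=
  ∑ e : E, (if G.ends e = s(v, v) then 2 else if v ∈ G.ends e then 1 else 0)

/-- `G` is trivalent: every vertex has degree `3`. -/
def Trivalent [Fintype E] : Prop := ∀ v : V, G.degree v = 3

/-- `A ⊆ V` is the vertex set of a cycle `v₁, …, vₙ, v₁` of `G`: there are
pairwise distinct vertices `f 0, …, f (n-1)` with range `A` and pairwise
distinct edges joining cyclically consecutive vertices. -/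
def IsCycleSet (A : Set V) : Prop :=
  ∃ n : ℕ, 0 < n ∧ ∃ f : ZMod n → V, Function.Injective f ∧ Set.range f = A ∧
    ∃ e : ZMod n → E, Function.Injective e ∧ ∀ i, G.ends (e i) = s(f i, f (i + 1))

/-- The subgraph induced on `A` contains a cycle. -/
def Cyclic (A : Set V) : Prop := ∃ C ⊆ A, G.IsCycleSet C

/-- The subgraph induced on `A` is acyclic (a forest). -/
def Acyclic (A : Set V) : Prop := ¬ G.Cyclic A

/-- `A` is a circuit of the graph curve matroid `M_G`: `A` is nonempty,
`r*(δ(A)) ≤ |A|`, and no proper nonempty subset `A'` satisfies `r*(δ(A')) ≤ |A'|`. -/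
noncomputable def IsCircuitMG (A : Set V) : Prop :=
  A.Nonempty ∧ G.bondRank (G.inc A) ≤ A.ncard ∧
    ∀ A' : Set V, A' ⊂ A → A'.Nonempty → A'.ncard < G.bondRank (G.inc A')

/-- `A` is dependent in the graph curve matroid `M_G`, i.e. contains a circuit. -/
noncomputable def DepMG (A : Set V) : Prop := ∃ C ⊆ A, G.IsCircuitMG C

/-- `A` is independent in the graph curve matroid `M_G`. -/
noncomputable def IndepMG (A : Set V) : Prop := ¬ G.DepMG A

/-- The rank function of the graph curve matroid `M_G`:
the maximal cardinality of an independent subset. -/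
noncomputable def rankMG (A : Set V) : ℕ :=
  sSup {n | ∃ I ⊆ A, G.IndepMG I ∧ I.ncard = n}

/-- `B` is a basis of the graph curve matroid `M_G`:
a maximal independent set. -/
noncomputable def IsBasisMG (B : Set V) : Prop :=
  G.IndepMG B ∧ ∀ I : Set V, G.IndepMG I → B ⊆ I → I = B

end Multigraph

namespace Multigraph

section Helpers

variable {V E : Type*} (G : Multigraph V E)

/-- Functions constant along the edges of `X`. -/
def constSub (X : Set E) : Submodule ℚ (V → ℚ) where
  carrier := {f | ∀ e ∈ X, ∀ u v, G.ends e = s(u, v) → f u = f v}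
  add_mem' := by
    intro f g hf hg e he u v h
    simp [hf e he u v h, hg e he u v h]
  zero_mem' := by
    intro e he u v h
    rfl
  smul_mem' := by
    intro c f hf e he u v h
    simp [hf e he u v h]

lemma mem_constSub {X : Set E} {f : V → ℚ} :
    f ∈ G.constSub X ↔ ∀ e ∈ X, ∀ u v, G.ends e = s(u, v) → f u = f v := Iff.rfl

/-- Functions constant along edges are functions on the components. -/
def constEquiv (X : Set E) :
    (Quot (fun u v : V => ∃ e ∈ X, G.ends e = s(u, v)) → ℚ) ≃ₗ[ℚ] G.constSub X where
  toFun g := ⟨fun v => g (Quot.mk _ v), by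
    intro e he u v h
    exact congrArg g (Quot.sound ⟨e, he, h⟩)⟩
  invFun f := Quot.lift f.1 (by
    rintro u v ⟨e, he, h⟩
    exact f.2 e he u v h)
  map_add' := by intro f g; rfl
  map_smul' := by intro c g; rfl
  left_inv := by
    intro g
    funext q
    induction q using Quot.ind
    rfl
  right_inv := by intro f; rfl

lemma finrank_constSub [Fintype V] (X : Set E) :
    Module.finrank ℚ (G.constSub X) = G.numComponentsEdges X := by
  classical
  have : Finite (Quot (fun u v : V => ∃ e ∈ X, G.ends e = s(u, v))) := Quot.finite _
  have := Fintype.ofFinite (Quot (fun u v : V => ∃ e ∈ X, G.ends e = s(u, v)))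
  rw [← (G.constEquiv X).finrank_eq, Module.finrank_fintype_fun_eq_card,
    numComponentsEdges, Nat.card_eq_fintype_card]

lemma nce_le_card [Fintype V] (X : Set E) : G.numComponentsEdges X ≤ Nat.card V := by
  rw [← finrank_constSub]
  refine (Submodule.finrank_le _).trans ?_
  rw [Module.finrank_fintype_fun_eq_card, Nat.card_eq_fintype_card]

lemma nce_super [Fintype V] (X Y : Set E) :
    G.numComponentsEdges X + G.numComponentsEdges Y ≤
      G.numComponentsEdges (X ∪ Y) + G.numComponentsEdges (X ∩ Y) := by
  simp only [← finrank_constSub]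
  have h1 := Submodule.finrank_sup_add_finrank_inf_eq (G.constSub X) (G.constSub Y)
  have h2 : G.constSub X ⊓ G.constSub Y ≤ G.constSub (X ∪ Y) := by
    rintro f ⟨hX, hY⟩ e (he | he) u v h
    · exact hX e he u v h
    · exact hY e he u v h
  have h3 : G.constSub X ⊔ G.constSub Y ≤ G.constSub (X ∩ Y) := by
    refine sup_le ?_ ?_
    · intro f hf e he u v h
      exact hf e he.1 u v h
    · intro f hf e he u v h
      exact hf e he.2 u v h
  have h4 := Submodule.finrank_mono h2
  have h5 := Submodule.finrank_mono h3
  omega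

lemma card_le_nce_add [Fintype V] [Fintype E] (Y : Set E) :
    Nat.card V ≤ G.numComponentsEdges Y + Y.ncard := by
  classical
  rw [← finrank_constSub]
  let d : (V → ℚ) →ₗ[ℚ] (Y → ℚ) :=
    LinearMap.pi (fun e =>
      (LinearMap.proj (Quot.out (G.ends e.1)).1 : (V → ℚ) →ₗ[ℚ] ℚ) -
      (LinearMap.proj (Quot.out (G.ends e.1)).2 : (V → ℚ) →ₗ[ℚ] ℚ))
  have h := LinearMap.finrank_range_add_finrank_ker d
  have h1 : LinearMap.ker d ≤ G.constSub Y := by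
    intro f hf e he u v huv
    have h2 : d f ⟨e, he⟩ = 0 := by
      rw [LinearMap.mem_ker.1 hf]; rfl
    have h3 : f (Quot.out (G.ends e)).1 = f (Quot.out (G.ends e)).2 := by
      have : f (Quot.out (G.ends e)).1 - f (Quot.out (G.ends e)).2 = 0 := h2
      linarith
    have h4 : s((Quot.out (G.ends e)).1, (Quot.out (G.ends e)).2) = s(u, v) := by
      rw [← huv]
      exact Quot.out_eq (G.ends e)
    rcases Sym2.eq_iff.1 h4 with ⟨a, b⟩ | ⟨a, b⟩
    · rw [← a, ← b, h3]
    · rw [← a, ← b, h3]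
  have h5 := Submodule.finrank_mono h1
  have h6 : Module.finrank ℚ (LinearMap.range d) ≤ Y.ncard := by
    refine (Submodule.finrank_le _).trans ?_
    rw [Module.finrank_fintype_fun_eq_card, ← Nat.card_eq_fintype_card, Nat.card_coe_set_eq]
  rw [Module.finrank_fintype_fun_eq_card, ← Nat.card_eq_fintype_card] at h
  omega

lemma nce_le_union_add [Fintype V] [Fintype E] (X Y : Set E) :
    G.numComponentsEdges X ≤ G.numComponentsEdges (X ∪ Y) + Y.ncard := by
  have h1 := G.nce_super X Y
  have h2 := G.nce_le_card (X ∩ Y)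
  have h3 := G.card_le_nce_add Y
  omega

lemma bondRank_eq [Fintype V] [Fintype E] (hc : G.Connected) (X : Set E) :
    G.bondRank X + G.numComponentsEdges Xᶜ = X.ncard + 1 := by
  have h1 := G.nce_le_card Xᶜ
  have h2 := G.nce_le_card Set.univ
  have h3 := G.nce_le_union_add Xᶜ X
  rw [Set.compl_union_self] at h3
  unfold bondRank cycleRank
  unfold Connected at hc
  omega

lemma bondRank_submod [Fintype V] [Fintype E] (hc : G.Connected) (X Y : Set E) :
    G.bondRank (X ∪ Y) + G.bondRank (X ∩ Y) ≤ G.bondRank X + G.bondRank Y := by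
  have h1 := G.bondRank_eq hc X
  have h2 := G.bondRank_eq hc Y
  have h3 := G.bondRank_eq hc (X ∪ Y)
  have h4 := G.bondRank_eq hc (X ∩ Y)
  have h5 := G.nce_super Xᶜ Yᶜ
  have h6 := Set.ncard_union_add_ncard_inter X Y
  rw [Set.compl_union] at h3
  rw [Set.compl_inter] at h4
  omega

lemma bondRank_mono [Fintype V] [Fintype E] (hc : G.Connected) {X Y : Set E} (h : X ⊆ Y) :
    G.bondRank X ≤ G.bondRank Y := by
  have h1 := G.bondRank_eq hc X
  have h2 := G.bondRank_eq hc Y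
  have h3 := G.nce_le_union_add Yᶜ (Y \ X)
  have h4 : Yᶜ ∪ (Y \ X) = Xᶜ := by
    ext e
    have := @h e
    simp only [Set.mem_union, Set.mem_compl_iff, Set.mem_sdiff]
    tauto
  rw [h4] at h3
  have h5 := Set.ncard_sdiff_add_ncard_of_subset h
  omega

lemma bondRank_pos [Fintype V] [Fintype E] (h2 : G.TwoEdgeConnected) {X : Set E} {e : E}
    (he : e ∈ X) : 1 ≤ G.bondRank X := by
  have h := G.bondRank_mono h2.1 (Set.singleton_subset_iff.2 he)
  have h1 := G.bondRank_eq h2.1 {e}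
  rw [h2.2 e, Set.ncard_singleton] at h1
  omega

/-- Edges with both ends in `A`. -/
def inside (A : Set V) : Set E := {e | ∀ v ∈ G.ends e, v ∈ A}

lemma compl_inc (A : Set V) : (G.inc A)ᶜ = G.inside Aᶜ := by
  ext e
  simp only [inc, inside, Set.mem_compl_iff, Set.mem_ofPred_eq]
  constructor
  · intro h v hv hA
    exact h ⟨v, hA, hv⟩
  · rintro h ⟨v, hA, hv⟩
    exact h v hv hA

open Classical in
/-- Components of `(V, E(A))`. -/
noncomputable def insideEquiv (A : Set V) :
    Quot (fun u v : V => ∃ e ∈ G.inside A, G.ends e = s(u, v)) ≃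
      Quot (fun x y : A => ∃ e, G.ends e = s(x.1, y.1)) ⊕ (Aᶜ : Set V) where
  toFun := Quot.lift (fun v => if h : v ∈ A then Sum.inl (Quot.mk _ ⟨v, h⟩) else Sum.inr ⟨v, h⟩) (by
    rintro u v ⟨e, he, h⟩
    have hu : u ∈ A := he u (by rw [h]; simp)
    have hv : v ∈ A := he v (by rw [h]; simp)
    simp only [hu, hv, dif_pos]
    exact congrArg Sum.inl (Quot.sound ⟨e, h⟩))
  invFun := Sum.elim (Quot.lift (fun x => Quot.mk _ x.1) (by
    rintro x y ⟨e, h⟩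
    refine Quot.sound ⟨e, ?_, h⟩
    intro v hv
    rw [h, Sym2.mem_iff] at hv
    rcases hv with rfl | rfl
    · exact x.2
    · exact y.2)) (fun x => Quot.mk _ x.1)
  left_inv := by
    intro q
    induction q using Quot.ind with
    | mk v =>
      by_cases h : v ∈ A
      · simp [h]
      · simp [h]
  right_inv := by
    rintro (q | ⟨x, hx⟩)
    · induction q using Quot.ind with
      | mk x => simp
    · have hx' : x ∉ A := hx
      simp [hx']

lemma nce_inside [Fintype V] (A : Set V) :
    G.numComponentsEdges (G.inside A) = G.numComponentsSub A + Aᶜ.ncard := by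
  have : Finite (Quot (fun x y : A => ∃ e, G.ends e = s(x.1, y.1))) := Quot.finite _
  rw [numComponentsEdges, Nat.card_congr (G.insideEquiv A), Nat.card_sum, Nat.card_coe_set_eq,
    numComponentsSub]

lemma degree_sum [Fintype V] [Fintype E] (h3 : G.Trivalent) (A : Set V) :
    3 * A.ncard = (G.inc A).ncard + (G.inside A).ncard := by
  classical
  have key : ∀ e : E, (∑ v ∈ A.toFinset, (if G.ends e = s(v, v) then 2 else
      if v ∈ G.ends e then 1 else 0)) =
      (if e ∈ G.inc A then 1 else 0) + (if e ∈ G.inside A then 1 else 0) := by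
    intro e
    obtain ⟨⟨a, b⟩, hab⟩ := Quot.exists_rep (G.ends e)
    have hab' : G.ends e = s(a, b) := hab.symm
    have h1 : (e ∈ G.inc A) ↔ (a ∈ A ∨ b ∈ A) := by
      simp only [inc, Set.mem_ofPred_eq, hab', Sym2.mem_iff]
      constructor
      · rintro ⟨v, hv, rfl | rfl⟩
        · exact Or.inl hv
        · exact Or.inr hv
      · rintro (h | h)
        · exact ⟨a, h, Or.inl rfl⟩
        · exact ⟨b, h, Or.inr rfl⟩
    have h2 : (e ∈ G.inside A) ↔ (a ∈ A ∧ b ∈ A) := by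
      simp [inside, hab']
    have h4 : ∀ v, (if G.ends e = s(v, v) then 2 else if v ∈ G.ends e then 1 else 0) =
        (if v = a then 1 else 0) + (if v = b then 1 else 0) := by
      intro v
      simp only [hab', Sym2.mem_iff, Sym2.eq_iff]
      by_cases ha : v = a <;> by_cases hb : v = b <;> simp [ha, hb] <;> grind
    simp only [h4, Finset.sum_add_distrib, Finset.sum_ite_eq', Set.mem_toFinset, h1, h2]
    by_cases ha : a ∈ A <;> by_cases hb : b ∈ A <;> simp [ha, hb]
  have h5 : ∑ v ∈ A.toFinset, G.degree v = 3 * A.ncard := by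
    rw [Finset.sum_congr rfl (fun v _ => h3 v), Finset.sum_const, Set.ncard_eq_toFinset_card']
    simp [mul_comm]
  rw [← h5]
  unfold degree
  have h6 : ∑ v ∈ A.toFinset, ∑ e : E, (if G.ends e = s(v, v) then 2 else
      if v ∈ G.ends e then 1 else 0) = (G.inc A).ncard + (G.inside A).ncard := by
    rw [Finset.sum_comm, Finset.sum_congr rfl (fun e _ => key e), Finset.sum_add_distrib]
    simp [Set.ncard_eq_toFinset_card', Set.toFinset]
  convert h6 using 4

/-- The key formula `r*(δ(A)) = 2|A| - e(A) - ω(A^c) + 1`. -/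
lemma bondRank_inc [Fintype V] [Fintype E] (h3 : G.Trivalent) (hc : G.Connected) (A : Set V) :
    G.bondRank (G.inc A) + G.numComponentsSub Aᶜ + (G.inside A).ncard = 2 * A.ncard + 1 := by
  have h1 := G.bondRank_eq hc (G.inc A)
  rw [compl_inc, nce_inside, compl_compl] at h1
  have h2 := G.degree_sum h3 A
  omega

lemma ncs_pos [Fintype V] {A : Set V} (h : A.Nonempty) : 1 ≤ G.numComponentsSub A := by
  have : Finite (Quot (fun x y : A => ∃ e, G.ends e = s(x.1, y.1))) := Quot.finite _
  obtain ⟨a, ha⟩ := h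
  have : Nonempty (Quot (fun x y : A => ∃ e, G.ends e = s(x.1, y.1))) := ⟨Quot.mk _ ⟨a, ha⟩⟩
  exact Nat.card_pos

lemma ncard_le_ncs_add [Fintype V] [Fintype E] (A : Set V) :
    A.ncard ≤ G.numComponentsSub A + (G.inside A).ncard := by
  have h1 := G.card_le_nce_add (G.inside A)
  rw [nce_inside] at h1
  have h2 := Set.ncard_add_ncard_compl A
  omega

lemma indep_lt [Fintype V] {B : Set V} (hB : G.IndepMG B) :
    ∀ (n : ℕ) (A : Set V), A.ncard = n → A ⊆ B → A.Nonempty → A.ncard < G.bondRank (G.inc A) := by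
  intro n
  induction n using Nat.strong_induction_on with
  | _ n ih =>
    intro A hn hA hne
    by_contra hlt
    refine hB ⟨A, hA, hne, not_lt.1 hlt, ?_⟩
    intro A' hA' hne'
    exact ih A'.ncard (hn ▸ Set.ncard_lt_ncard hA') A' rfl (hA'.1.trans hA) hne'

lemma exists_crossing (hc : G.Connected) {T : Set V} (hT : T.Nonempty) (hne : T ≠ Set.univ) :
    ∃ e, ∃ u ∈ T, ∃ w, w ∉ T ∧ u ∈ G.ends e ∧ w ∈ G.ends e := by
  by_contra hcon
  push Not at hcon
  obtain ⟨a, ha⟩ := hT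
  obtain ⟨b, hb⟩ := (Set.ne_univ_iff_exists_notMem T).1 hne
  let g : Quot (fun u v : V => ∃ e ∈ (Set.univ : Set E), G.ends e = s(u, v)) → Prop :=
    Quot.lift (fun v => v ∈ T) (by
      rintro u v ⟨e, -, h⟩
      have hu : u ∈ G.ends e := by rw [h]; simp
      have hv : v ∈ G.ends e := by rw [h]; simp
      apply propext
      constructor
      · intro h1
        by_contra h2
        exact hcon e u h1 v h2 hu hv
      · intro h1
        by_contra h2
        exact hcon e v h1 u h2 hv hu)
  have hs : Subsingleton (Quot (fun u v : V => ∃ e ∈ (Set.univ : Set E), G.ends e = s(u, v))) :=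
    (Nat.card_eq_one_iff_unique.1 hc).1
  have : g (Quot.mk _ a) = g (Quot.mk _ b) := congrArg g (hs.elim (Quot.mk _ a) (Quot.mk _ b))
  have h2 : (a ∈ T) = (b ∈ T) := this
  exact hb (h2 ▸ ha)

lemma inc_union (A B : Set V) : G.inc (A ∪ B) = G.inc A ∪ G.inc B := by
  ext e
  simp only [inc, Set.mem_ofPred_eq, Set.mem_union]
  constructor
  · rintro ⟨v, h | h, hv⟩
    · exact Or.inl ⟨v, h, hv⟩
    · exact Or.inr ⟨v, h, hv⟩
  · rintro (⟨v, h, hv⟩ | ⟨v, h, hv⟩)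
    · exact ⟨v, Or.inl h, hv⟩
    · exact ⟨v, Or.inr h, hv⟩

lemma inc_mono {A B : Set V} (h : A ⊆ B) : G.inc A ⊆ G.inc B := by
  rintro e ⟨v, hv, hve⟩
  exact ⟨v, h hv, hve⟩

lemma good_union [Fintype V] [Fintype E] (h2 : G.TwoEdgeConnected) {B : Set V}
    (hB : G.IndepMG B) {S T : Set V}
    (hS : G.bondRank (G.inc S) ≤ (S ∩ B).ncard + 1)
    (hT : G.bondRank (G.inc T) ≤ (T ∩ B).ncard + 1)
    {e : E} (he : e ∈ G.inc S ∩ G.inc T) :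
    G.bondRank (G.inc (S ∪ T)) ≤ ((S ∪ T) ∩ B).ncard + 1 := by
  have h := G.bondRank_submod h2.1 (G.inc S) (G.inc T)
  rw [← inc_union] at h
  have hc := Set.ncard_union_add_ncard_inter (S ∩ B) (T ∩ B)
  rw [← Set.union_inter_distrib_right] at hc
  have hk : ((S ∩ B) ∩ (T ∩ B)).ncard + 1 ≤ G.bondRank (G.inc S ∩ G.inc T) := by
    rcases Set.eq_empty_or_nonempty ((S ∩ B) ∩ (T ∩ B)) with h0 | h0
    · rw [h0, Set.ncard_empty]
      exact G.bondRank_pos h2 he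
    · have h4 := G.indep_lt hB _ _ rfl (fun x hx => hx.1.2) h0
      refine Nat.succ_le_of_lt (h4.trans_le (G.bondRank_mono h2.1 ?_))
      exact Set.subset_inter (G.inc_mono (fun x hx => hx.1.1)) (G.inc_mono (fun x hx => hx.2.1))
  omega

lemma univ_good [Fintype V] [Fintype E] (h3 : G.Trivalent) (h2 : G.TwoEdgeConnected)
    [Nonempty V] {B : Set V} (hB : G.IsBasisMG B)
    (hBu : B ≠ Set.univ) :
    G.bondRank (G.inc Set.univ) ≤ B.ncard + 1 := by
  have hgood : ∀ v : V, ∃ T : Set V, v ∈ T ∧ G.bondRank (G.inc T) ≤ (T ∩ B).ncard + 1 := by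
    intro v
    by_cases hv : v ∈ B
    · refine ⟨{v}, rfl, ?_⟩
      have h := G.bondRank_inc h3 h2.1 {v}
      have hne : ({v}ᶜ : Set V).Nonempty := by
        obtain ⟨b, hb⟩ := (Set.ne_univ_iff_exists_notMem B).1 hBu
        refine ⟨b, ?_⟩
        rintro rfl
        exact hb hv
      have h1 := G.ncs_pos hne
      have h4 : ({v} : Set V) ∩ B = {v} := Set.inter_eq_left.2 (Set.singleton_subset_iff.2 hv)
      rw [h4, Set.ncard_singleton] at *
      omega
    · have hd : ¬ G.IndepMG (insert v B) := by
        intro hi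
        have := hB.2 _ hi (Set.subset_insert v B)
        exact hv (this ▸ Set.mem_insert v B)
      obtain ⟨C, hC, hne, hle, -⟩ := not_not.1 hd
      have hvC : v ∈ C := by
        by_contra hvC
        have hCB : C ⊆ B := by
          intro x hx
          rcases hC hx with rfl | h
          · exact absurd hx hvC
          · exact h
        have := G.indep_lt hB.1 _ C rfl hCB hne
        omega
      refine ⟨C, hvC, hle.trans ?_⟩
      have : C ⊆ insert v (C ∩ B) := by
        intro x hx
        rcases hC hx with rfl | h
        · exact Or.inl rfl
        · exact Or.inr ⟨hx, h⟩
      exact (Set.ncard_le_ncard this).trans (Set.ncard_insert_le _ _)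
  let F : Set (Set V) := {T | T.Nonempty ∧ G.bondRank (G.inc T) ≤ (T ∩ B).ncard + 1}
  have hF : F.Nonempty := by
    obtain ⟨v⟩ := ‹Nonempty V›
    obtain ⟨T, hv, hT⟩ := hgood v
    exact ⟨T, ⟨v, hv⟩, hT⟩
  obtain ⟨T, hT⟩ := (Set.toFinite F).exists_maximal hF
  have hu : T = Set.univ := by
    by_contra hne
    obtain ⟨e, u, hu, w, hw, hue, hwe⟩ := G.exists_crossing h2.1 hT.1.1 hne
    obtain ⟨S, hwS, hS⟩ := hgood w
    have hun := G.good_union h2 hB.1 hT.1.2 hS (e := e) ⟨⟨u, hu, hue⟩, ⟨w, hwS, hwe⟩⟩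
    have hle : T ∪ S ⊆ T := hT.2 (y := T ∪ S) ⟨⟨u, Or.inl hu⟩, hun⟩ Set.subset_union_left
    exact hw (hle (Or.inr hwS))
  have := hT.1.2
  rw [hu, Set.univ_inter] at this
  exact this

lemma forest_bound [Fintype V] [Fintype E] {B : Set V}
    (h : ∀ A ⊆ B, A.Nonempty → (G.inside A).ncard + 1 ≤ A.ncard) :
    G.numComponentsSub B + (G.inside B).ncard ≤ B.ncard := by
  classical
  have : Finite (Quot (fun x y : B => ∃ e, G.ends e = s(x.1, y.1))) := Quot.finite _
  have := Fintype.ofFinite (Quot (fun x y : B => ∃ e, G.ends e = s(x.1, y.1)))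
  let C : Quot (fun x y : B => ∃ e, G.ends e = s(x.1, y.1)) → Set V :=
    fun q => {v | ∃ hv : v ∈ B, Quot.mk _ ⟨v, hv⟩ = q}
  have hCB : ∀ q, C q ⊆ B := fun q v hv => hv.1
  have hCne : ∀ q, (C q).Nonempty := by
    intro q
    induction q using Quot.ind with
    | mk x => exact ⟨x.1, x.2, rfl⟩
  have h1 : ∑ q, (C q).ncard ≤ B.ncard := by
    simp only [Set.ncard_eq_toFinset_card']
    rw [← Finset.card_biUnion]
    · apply Finset.card_le_card
      intro v hv
      simp only [Finset.mem_biUnion, Set.mem_toFinset] at hv ⊢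
      obtain ⟨q, -, hq⟩ := hv
      exact hCB q hq
    · intro p _ q _ hpq
      refine Finset.disjoint_left.2 ?_
      intro v hp hq
      rw [Set.mem_toFinset] at hp hq
      obtain ⟨a, ha⟩ := hp
      obtain ⟨b, hb⟩ := hq
      exact hpq (ha.symm.trans hb)
  have h2 : (G.inside B).ncard ≤ ∑ q, (G.inside (C q)).ncard := by
    simp only [Set.ncard_eq_toFinset_card']
    refine le_trans (Finset.card_le_card ?_) Finset.card_biUnion_le
    intro e he
    simp only [Finset.mem_biUnion, Set.mem_toFinset, Finset.mem_univ, true_and] at he ⊢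
    obtain ⟨⟨a, b⟩, hab⟩ := Quot.exists_rep (G.ends e)
    have hab' : G.ends e = s(a, b) := hab.symm
    have ha : a ∈ B := he a (by rw [hab']; simp)
    have hb : b ∈ B := he b (by rw [hab']; simp)
    refine ⟨Quot.mk _ ⟨a, ha⟩, ?_⟩
    intro v hv
    rw [hab', Sym2.mem_iff] at hv
    rcases hv with rfl | rfl
    · exact ⟨ha, rfl⟩
    · exact ⟨hb, (Quot.sound ⟨e, hab'⟩).symm⟩
  have h4 : ∑ q, ((G.inside (C q)).ncard + 1) ≤ ∑ q, (C q).ncard :=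
    Finset.sum_le_sum (fun q _ => h (C q) (hCB q) (hCne q))
  rw [Finset.sum_add_distrib] at h4
  have h5 : G.numComponentsSub B = Fintype.card (Quot (fun x y : B => ∃ e, G.ends e = s(x.1, y.1))) :=
    Nat.card_eq_fintype_card
  simp only [Finset.sum_const, Finset.card_univ, smul_eq_mul, mul_one] at h4
  omega

end Helpers

end Multigraph

/-- For a trivalent 2-edge-connected finite graph `G` and any
basis `B` of the graph curve matroid `M_G`, the number of connected components
of `G[B]` equals that of `G[V-B]`. -/
theorem basis_components_eq {V E : Type*} [Fintype V] [Fintype E]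
    (G : Multigraph V E) (h3 : G.Trivalent) (h2 : G.TwoEdgeConnected)
    (B : Set V) (hB : G.IsBasisMG B) :
    G.numComponentsSub B = G.numComponentsSub Bᶜ := by
  have hc := h2.1
  have : Nonempty V := by
    obtain ⟨-, ⟨q⟩⟩ := Nat.card_eq_one_iff_unique.1 hc
    induction q using Quot.ind with
    | mk v => exact ⟨v⟩
  have hVpos : 0 < (Set.univ : Set V).ncard := by
    rw [Set.ncard_univ]; exact Nat.card_pos
  have hd := G.degree_sum h3 Set.univ
  have hfu := G.bondRank_inc h3 hc Set.univ
  have hincle := Set.ncard_le_ncard (Set.subset_univ (G.inc Set.univ))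
  have hins : G.inside Set.univ = Set.univ := by
    ext e; simp [Multigraph.inside]
  have hincu : G.inc (Set.univ : Set V) = Set.univ := by
    have := G.compl_inc (Set.univ : Set V)
    ext e
    obtain ⟨⟨a, b⟩, hab⟩ := Quot.exists_rep (G.ends e)
    have hab' : G.ends e = s(a, b) := hab.symm
    simp only [Set.mem_univ, iff_true]
    exact ⟨a, trivial, by rw [hab']; simp⟩
  have h0 : G.numComponentsSub (Set.univ : Set V)ᶜ = 0 := by
    rw [Set.compl_univ]
    have := G.nce_inside ∅
    have h6 := G.nce_le_card (G.inside ∅)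
    rw [Set.compl_empty, Set.ncard_univ] at this
    omega
  rw [hincu, hins] at hd hfu
  rw [h0] at hfu
  have hlt := fun A hA hne => G.indep_lt hB.1 _ A rfl hA hne
  have hBu : B ≠ Set.univ := by
    rintro rfl
    have := hlt Set.univ subset_rfl Set.univ_nonempty
    rw [hincu] at this
    omega
  have hu := G.univ_good h3 h2 hB hBu
  have hBne : B.Nonempty := by
    rw [Set.nonempty_iff_ne_empty]
    rintro rfl
    rw [hincu, Set.ncard_empty] at hu
    omega
  have hlow := hlt B subset_rfl hBne
  have hm := G.bondRank_mono hc (G.inc_mono (Set.subset_univ B))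
  have hform := G.bondRank_inc h3 hc B
  have hf := G.forest_bound (B := B) (by
    intro A hA hne
    have h5 := hlt A hA hne
    have h6 := G.bondRank_inc h3 hc A
    have h7 : 1 ≤ G.numComponentsSub Aᶜ := by
      apply G.ncs_pos
      rw [Set.nonempty_compl]
      rintro rfl
      exact hBu (Set.univ_subset_iff.1 hA)
    omega)
  have hg := G.ncard_le_ncs_add B
  omega
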